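/- arXiv:1108.1852 — 2 statements merged into one kernel-verified Lean document; each statement's English description precedes it below -/
import Mathlib

section
/- Let K be a finite field with q^n elements, let d be a positive divisor of n, and let A ∈ K[X] be a monic q-additive polynomial of degree q^t satisfying (*). Suppose α ∈ K is nonzero, X^{q^d} − α·X satisfies (*), and A divides X^{q^d} − α·X. Then |W(A|K)| ≥ q^{d·2^{n/d} − d + t}. -/
open Polynomial

/-- The polynomial `X ^ Q - X` is the product of the `X - x` over the fixed points `x` of the
`Q`-th power map, as soon as there are `Q` of them. -/
theorem X_pow_sub_X_eq_prod_of_card {K : Type*} [Field K] {Q : ℕ} (hQ : 1 < Q) {F : Finset K}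
    (hF : ∀ x, x ∈ F ↔ x ^ Q = x) (hcard : F.card = Q) :
    (X ^ Q - X : K[X]) = ∏ x ∈ F, (X - C x) := by
  have hmonic : (X ^ Q - X : K[X]).Monic :=
    monic_X_pow_sub (by rw [degree_X]; exact_mod_cast hQ)
  refine (eq_of_dvd_of_natDegree_le_of_leadingCoeff
    (Finset.prod_dvd_of_coprime ?_ ?_) ?_ ?_).symm
  · intro x _ y _ hxy
    exact isCoprime_X_sub_C_of_isUnit_sub (sub_ne_zero.2 hxy).isUnit
  · intro x hx
    rw [dvd_iff_isRoot]
    simp [(hF x).1 hx]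
  · rw [FiniteField.X_pow_card_sub_X_natDegree_eq K hQ,
      natDegree_finsetProd_X_sub_C_eq_card, hcard]
  · rw [hmonic.leadingCoeff, (monic_prod_X_sub_C _ _).leadingCoeff]

/-- A monic additive divisor `A` of `X ^ Q - X` is a left compositional factor of it, and the
cofactor has a nonzero constant derivative. -/
theorem exists_comp_eq_X_pow_sub_X {K : Type*} [Field K] {p r : ℕ} [Fact p.Prime] [CharP K p]
    (hr : r ≠ 0) {F : Finset K} (hF : ∀ x, x ∈ F ↔ x ^ p ^ r = x) (hcard : F.card = p ^ r)
    {A : K[X]} (hA : A.Monic) (hA0 : A.natDegree ≠ 0)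
    (hadd : ∀ f g : K[X], A.comp (f - g) = A.comp f - A.comp g)
    {a : K} (hder : derivative A = C a) (hdvd : A ∣ X ^ p ^ r - X) :
    ∃ (B : K[X]) (b : K), B.natDegree * A.natDegree = p ^ r ∧ b ≠ 0 ∧ derivative B = C b ∧
      A.comp B = X ^ p ^ r - X := by
  classical
  set Q := p ^ r with hQdef
  have hQ : 1 < Q := Nat.one_lt_pow hr (Fact.out : p.Prime).one_lt
  set P : K[X] := X ^ Q - X with hP
  have hPmonic : P.Monic := monic_X_pow_sub (by rw [degree_X]; exact_mod_cast hQ)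
  have hPprod : P = ∏ x ∈ F, (X - C x) := X_pow_sub_X_eq_prod_of_card hQ hF hcard
  set B : K[X] := ∏ w ∈ F.image (fun x => A.eval x), (X - C w) with hB
  have hBA : B.comp A = ∏ w ∈ F.image (fun x => A.eval x), (A - C w) := by
    simp [hB, prod_comp]
  have hBAP : B.comp A = P := by
    refine eq_of_monic_of_associated ((monic_prod_X_sub_C _ _).comp hA hA0) hPmonic
      (associated_of_dvd_dvd ?_ ?_)
    · rw [hBA]
      refine Finset.prod_dvd_of_coprime ?_ ?_
      · intro x _ y _ hxy
        have := (isCoprime_X_sub_C_of_isUnit_sub (sub_ne_zero.2 hxy).isUnit).map (compRingHom A)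
        simpa using this
      · intro w hw
        obtain ⟨x, hx, rfl⟩ := Finset.mem_image.1 hw
        have h1 : A.comp (X - C x) = A - C (A.eval x) := by rw [hadd]; simp
        have h2 : P.comp (X - C x) = P := by
          have : (X - C x : K[X]) ^ Q = X ^ Q - C x := by
            rw [sub_pow_char_pow, ← C_pow, (hF x).1 hx]
          simp [hP, this]
        rw [← h1, ← h2]
        exact map_dvd (compRingHom (X - C x)) hdvd
    · rw [hBA, hPprod]
      refine Finset.prod_dvd_of_coprime ?_ ?_
      · intro x _ y _ hxy
        exact isCoprime_X_sub_C_of_isUnit_sub (sub_ne_zero.2 hxy).isUnit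
      · intro x hx
        refine dvd_trans ?_ (Finset.dvd_prod_of_mem _ (Finset.mem_image_of_mem _ hx))
        rw [dvd_iff_isRoot]
        simp
  have hdeg : B.natDegree * A.natDegree = Q := by
    rw [← natDegree_comp, hBAP, FiniteField.X_pow_card_sub_X_natDegree_eq K hQ]
  have hQK : ((Q : ℕ) : K) = 0 := by simp [hQdef, hr]
  have hBder : (derivative B).comp A * C a = -1 := by
    have := congrArg derivative hBAP
    rw [derivative_comp, hder, hP] at this
    simpa [derivative_X_pow, hQK, mul_comm] using this
  have ha : a ≠ 0 := by
    rintro rfl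
    simp at hBder
  have hB' : (derivative B).comp A = C (-a⁻¹) := by
    have h2 : (C a : K[X]) * C a⁻¹ = 1 := by rw [← C_mul, mul_inv_cancel₀ ha, C_1]
    calc (derivative B).comp A = ((derivative B).comp A * C a) * C a⁻¹ := by
          rw [mul_assoc, h2, mul_one]
      _ = _ := by rw [hBder]; simp
  have hB'' : derivative B = C (-a⁻¹) := by
    have h0 : (derivative B - C (-a⁻¹)).comp A = 0 := by rw [sub_comp, hB', C_comp, sub_self]
    rcases comp_eq_zero_iff.1 h0 with h | h
    · exact sub_eq_zero.1 h
    · exact absurd (by rw [h.2, natDegree_C]) hA0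
  refine ⟨B, -a⁻¹, hdeg, by simpa using ha, hB'', ?_⟩
  have hAQ : A.comp (X ^ Q) = A ^ Q := by
    have hsplit : A.Splits := by
      refine Splits.of_dvd ?_ hPmonic.ne_zero hdvd
      rw [hPprod]
      exact Splits.prod fun x _ => Splits.X_sub_C x
    have hroot : ∀ x ∈ A.roots, x ^ Q = x := by
      intro x hx
      have := (isRoot_of_mem_roots hx).dvd hdvd
      simpa [hP, sub_eq_zero] using this
    have hprod := hsplit.eq_prod_roots_of_monic hA
    have : ∀ s : Multiset K, (∀ x ∈ s, x ^ Q = x) →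
        ((s.map fun x => X - C x).prod).comp (X ^ Q) = ((s.map fun x => X - C x).prod) ^ Q := by
      intro s
      induction s using Multiset.induction_on with
      | empty => simp
      | cons x s ih =>
        intro hs
        have hx := hs x (by simp)
        have hpow : (X - C x : K[X]) ^ Q = X ^ Q - C x := by
          rw [sub_pow_char_pow, ← C_pow, hx]
        simp only [Multiset.map_cons, Multiset.prod_cons, mul_comp, mul_pow, hpow]
        rw [ih fun y hy => hs y (by simp [hy])]
        simp
    rw [hprod]
    exact this _ hroot
  have h0 : (A.comp B - P).comp A = 0 := by
    rw [sub_comp, comp_assoc, hBAP, hP, hadd, hAQ]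
    simp
  rcases comp_eq_zero_iff.1 h0 with h | h
  · exact sub_eq_zero.1 h
  · exact absurd (by rw [h.2, natDegree_C]) hA0

/-- Galois descent for a permutation twisted by Frobenius: a lower bound for the number of
`σ`-equivariant families. -/
theorem card_pow_le_card_twisted_fixed {K ι : Type*} [Field K] [Fintype K] [Fintype ι]
    {p r m : ℕ} [Fact p.Prime] [CharP K p] (hr : r ≠ 0) (hm : m ≠ 0)
    (hK : Fintype.card K = (p ^ r) ^ m)
    {F : Finset K} (hF : ∀ x, x ∈ F ↔ x ^ p ^ r = x) (hcard : F.card = p ^ r)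
    (σ : Equiv.Perm ι) (hσ : σ ^ m = 1) :
    (p ^ r) ^ Fintype.card ι ≤ {c : ι → K | ∀ s, c (σ s) = c s ^ p ^ r}.ncard := by
  classical
  set Q := p ^ r with hQdef
  have hQ : 1 < Q := Nat.one_lt_pow hr (Fact.out : p.Prime).one_lt
  set S : Set (ι → K) := {c | ∀ s, c (σ s) = c s ^ Q} with hS
  have hmem : ∀ v : ι → K,
      (fun s => ∑ i ∈ Finset.range m, v ((σ ^ i).symm s) ^ Q ^ i) ∈ S := by
    intro v s
    have hshift : ∀ i, v ((σ ^ i).symm s) = v ((σ ^ (i + 1)).symm (σ s)) := by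
      intro i
      congr 1
      rw [Equiv.eq_symm_apply, pow_succ', Equiv.Perm.mul_apply, Equiv.apply_symm_apply]
    have h1 := Finset.sum_range_succ (fun i => v ((σ ^ i).symm (σ s)) ^ Q ^ i) m
    rw [Finset.sum_range_succ', hσ, ← hK, FiniteField.pow_card] at h1
    simp only [pow_zero, pow_one] at h1
    have h2 := add_right_cancel h1
    have h3 : _ ^ Q = _ :=
      sum_pow_char_pow p r (Finset.range m) (fun i => v ((σ ^ i).symm s) ^ Q ^ i)
    simp only
    rw [← h2, h3]
    refine Finset.sum_congr rfl fun i _ => ?_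
    rw [hshift, pow_succ Q i, pow_mul]
  have hspan : Submodule.span K S = ⊤ := by
    by_contra hne
    obtain ⟨φ, hφ0, hφ⟩ := Submodule.exists_le_ker_of_lt_top _ (lt_top_iff_ne_top.2 hne)
    refine hφ0 (LinearMap.ext fun v => ?_)
    let w : ℕ → ι → K := fun i s => v ((σ ^ i).symm s) ^ Q ^ i
    let g : K[X] := ∑ i ∈ Finset.range m, C (φ (w i)) * X ^ Q ^ i
    have hg : g = 0 := by
      refine eq_zero_of_natDegree_lt_card_of_eval_eq_zero g (f := id) Function.injective_id ?_ ?_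
      · intro l
        have h := hφ (Submodule.subset_span (hmem (l • v)))
        rw [LinearMap.mem_ker] at h
        have he : (fun s => ∑ i ∈ Finset.range m, (l • v) ((σ ^ i).symm s) ^ Q ^ i)
            = ∑ i ∈ Finset.range m, l ^ Q ^ i • w i := by
          ext s
          simp [w, mul_pow]
        rw [he, map_sum] at h
        have hgl : g.eval l = ∑ i ∈ Finset.range m, l ^ Q ^ i * φ (w i) := by
          simp only [g, eval_finsetSum, eval_mul, eval_C, eval_pow, eval_X, mul_comm]
        simpa only [id, hgl, map_smul, smul_eq_mul] using h
      · rw [hK]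
        refine lt_of_le_of_lt (natDegree_sum_le_of_forall_le _ _ (n := Q ^ (m - 1)) fun i hi => ?_)
          (Nat.pow_lt_pow_right hQ (by omega))
        refine (natDegree_C_mul_X_pow_le _ _).trans (Nat.pow_le_pow_right (by omega) ?_)
        have := Finset.mem_range.1 hi
        omega
    have hc := congrArg (fun f => coeff f 1) hg
    have hiff : ∀ i, (1 = Q ^ i) ↔ i = 0 := by
      intro i
      rw [eq_comm, Nat.pow_eq_one]
      omega
    simp only [g, finsetSum_coeff, coeff_C_mul, coeff_X_pow, hiff, coeff_zero] at hc
    have hw : w 0 = v := by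
      ext s
      simp [w, ← Equiv.Perm.inv_def]
    simpa [hm.pos, hw, Nat.pos_iff_ne_zero, hm] using hc
  obtain ⟨b, hbS, hb, hli⟩ := exists_linearIndependent K S
  rw [hspan] at hb
  have hbcard : Fintype.card b = Fintype.card ι := by
    have e := Module.Basis.mk hli (by simp [hb])
    rw [← Module.finrank_eq_card_basis e, Module.finrank_fintype_fun_eq_card]
  have hinj : Function.Injective
      (fun (k : b → F) => ((∑ j, (k j : K) • (j : ι → K)) : ι → K)) := by
    intro k k' h
    funext j
    exact Subtype.ext (Fintype.linearIndependent_iffₛ.1 hli _ _ h j)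
  calc Q ^ Fintype.card ι = Nat.card (b → F) := by
        simp [hbcard, hcard]
    _ = (Set.range (fun (k : b → F) => ((∑ j, (k j : K) • (j : ι → K)) : ι → K))).ncard := by
        rw [← Set.image_univ, Set.ncard_image_of_injective _ hinj, Set.ncard_univ]
    _ ≤ S.ncard := by
        refine Set.ncard_le_ncard ?_ (Set.toFinite _)
        rintro _ ⟨k, rfl⟩ s
        have h3 : _ ^ Q = _ :=
          sum_pow_char_pow p r Finset.univ (fun j : b => (k j : K) * (j : ι → K) s)
        simp only [Finset.sum_apply, Pi.smul_apply, smul_eq_mul]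
        rw [h3]
        refine Finset.sum_congr rfl fun j _ => ?_
        rw [mul_pow, (hF _).1 (k j).2, hbS j.2 s]

/-- The natural number whose base `Q` digits are the given binary word. -/
def digitExponent (Q : ℕ) {m : ℕ} (s : Fin m → Fin 2) : ℕ := ∑ i, (s i : ℕ) * Q ^ (i : ℕ)

theorem digitExponent_injective {Q : ℕ} (hQ : 1 < Q) (m : ℕ) :
    Function.Injective (digitExponent Q (m := m)) := by
  intro s s' h
  have h2 : finFunctionFinEquiv (fun i => Fin.castLE hQ (s i)) =
      finFunctionFinEquiv (fun i => Fin.castLE hQ (s' i)) := by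
    ext
    simpa [finFunctionFinEquiv_apply, digitExponent] using h
  funext i
  exact Fin.castLE_injective hQ (congrFun (finFunctionFinEquiv.injective h2) i)

/-- The cyclic shift of binary words. -/
def wordShift (k : ℕ) : Equiv.Perm (Fin (k + 1) → Fin 2) :=
  (finRotate (k + 1)).arrowCongr (Equiv.refl _)

theorem wordShift_apply_add_one {k : ℕ} (s : Fin (k + 1) → Fin 2) (i : Fin (k + 1)) :
    wordShift k s (i + 1) = s i := by
  rw [← finRotate_apply]
  simp [wordShift, Equiv.arrowCongr]

theorem wordShift_pow (k : ℕ) : wordShift k ^ (k + 1) = 1 := by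
  have h : ∀ (j : ℕ) (s : Fin (k + 1) → Fin 2) (i : Fin (k + 1)),
      (wordShift k ^ j) s (i + j • 1) = s i := by
    intro j
    induction j with
    | zero => simp
    | succ j ih =>
      intro s i
      rw [pow_succ', Equiv.Perm.mul_apply, succ_nsmul, ← add_assoc, wordShift_apply_add_one, ih]
  ext1 s
  funext i
  have hk : (k + 1) • (1 : Fin (k + 1)) = 0 := by
    simpa only [Fintype.card_fin] using card_nsmul_eq_zero (x := (1 : Fin (k + 1)))
  simpa [hk] using h (k + 1) s i

theorem digitExponent_wordShift (Q : ℕ) {k : ℕ} (s : Fin (k + 1) → Fin 2) :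
    Q * digitExponent Q s + (wordShift k s 0 : ℕ) =
      digitExponent Q (wordShift k s) + (wordShift k s 0 : ℕ) * Q ^ (k + 1) := by
  have h0 : wordShift k s 0 = s (Fin.last k) := by
    simpa using wordShift_apply_add_one s (Fin.last k)
  have h1 : ∀ j : Fin k, wordShift k s j.succ = s j.castSucc := by
    intro j
    simpa using wordShift_apply_add_one s j.castSucc
  unfold digitExponent
  rw [Fin.sum_univ_castSucc, Fin.sum_univ_succ (fun i => (wordShift k s i : ℕ) * Q ^ (i : ℕ)),
    mul_add, Finset.mul_sum]
  simp only [h0, h1, Fin.val_castSucc, Fin.val_succ, Fin.val_last, Fin.val_zero, pow_zero, mul_one]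
  have h2 : ∑ j : Fin k, Q * ((s j.castSucc : ℕ) * Q ^ (j : ℕ)) =
      ∑ j : Fin k, (s j.castSucc : ℕ) * Q ^ ((j : ℕ) + 1) :=
    Finset.sum_congr rfl fun j _ => by ring
  rw [h2]
  ring

/-- The polynomial with prescribed coefficients at the exponents with binary base `Q` digits. -/
noncomputable def wordPolynomial {K : Type*} [Field K] (Q : ℕ) {m : ℕ}
    (c : (Fin m → Fin 2) → K) : K[X] :=
  ∑ s, C (c s) * X ^ digitExponent Q s

theorem wordPolynomial_injective {K : Type*} [Field K] {Q : ℕ} (hQ : 1 < Q) (m : ℕ) :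
    Function.Injective (wordPolynomial (K := K) Q (m := m)) := by
  intro c c' h
  have hc : ∀ (c : (Fin m → Fin 2) → K) s,
      (wordPolynomial Q c).coeff (digitExponent Q s) = c s := by
    intro c s
    simp [wordPolynomial, finsetSum_coeff, coeff_X_pow, (digitExponent_injective hQ m).eq_iff]
  funext s
  rw [← hc c, h, hc]

theorem X_pow_sub_X_pow_wordShift {K : Type*} [Field K] {Q k : ℕ} (hQ : (Q : K) = 0)
    (s : Fin (k + 1) → Fin 2) :
    (X ^ (Q * digitExponent Q s) - X ^ digitExponent Q (wordShift k s) : K[X]) =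
      (X ^ Q ^ (k + 1) - X) * derivative (X ^ digitExponent Q (wordShift k s)) := by
  have h := digitExponent_wordShift Q s
  have hcast := congrArg (Nat.cast (R := K)) h
  push_cast at hcast
  rw [hQ, zero_mul, zero_pow k.succ_ne_zero, mul_zero, add_zero, zero_add] at hcast
  rw [derivative_X_pow, ← hcast]
  generalize digitExponent Q (wordShift k s) = e at *
  obtain h0 | h0 : wordShift k s 0 = 0 ∨ wordShift k s 0 = 1 := by
    generalize wordShift k s 0 = x
    fin_cases x <;> simp
  · simp only [h0, Fin.val_zero, zero_mul, add_zero] at h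
    simp [h0, h]
  · simp only [h0, Fin.val_one, one_mul] at h
    simp only [h0, Fin.val_one, Nat.cast_one, map_one, one_mul]
    obtain _ | e := e
    · simp [h0] at hcast
    · rw [show Q * digitExponent Q s = Q ^ (k + 1) + e by omega]
      simp only [Nat.add_sub_cancel]
      ring

theorem wordPolynomial_pow_sub {K : Type*} [Field K] {p r k : ℕ} [Fact p.Prime] [CharP K p]
    (hr : r ≠ 0) {c : (Fin (k + 1) → Fin 2) → K} (hc : ∀ s, c (wordShift k s) = c s ^ p ^ r) :
    wordPolynomial (p ^ r) c ^ p ^ r - wordPolynomial (p ^ r) c =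
      (X ^ (p ^ r) ^ (k + 1) - X) * derivative (wordPolynomial (p ^ r) c) := by
  have h1 : wordPolynomial (p ^ r) c = ∑ s, C (c (wordShift k s)) *
      X ^ digitExponent (p ^ r) (wordShift k s) :=
    (Equiv.sum_comp (wordShift k) fun s => C (c s) * X ^ digitExponent (p ^ r) s).symm
  have h2 : wordPolynomial (p ^ r) c ^ p ^ r =
      ∑ s, C (c (wordShift k s)) * X ^ (p ^ r * digitExponent (p ^ r) s) := by
    rw [wordPolynomial, sum_pow_char_pow]
    refine Finset.sum_congr rfl fun s _ => ?_
    rw [mul_pow, ← C_pow, hc, ← pow_mul, mul_comm (digitExponent _ _)]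
  rw [h2, h1, ← Finset.sum_sub_distrib, derivative_sum, Finset.mul_sum]
  refine Finset.sum_congr rfl fun s _ => ?_
  rw [← mul_sub, X_pow_sub_X_pow_wordShift (by simp [hr]), derivative_C_mul]
  ring

theorem comp_sub_of_additive {K : Type*} [Field K] {p k : ℕ} [Fact p.Prime] [CharP K p]
    (m : ℕ) (ω : ℕ → K) (f g : K[X]) :
    (∑ i ∈ Finset.range m, C (ω i) * X ^ (p ^ k) ^ i : K[X]).comp (f - g) =
      (∑ i ∈ Finset.range m, C (ω i) * X ^ (p ^ k) ^ i : K[X]).comp f -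
        (∑ i ∈ Finset.range m, C (ω i) * X ^ (p ^ k) ^ i : K[X]).comp g := by
  simp only [Polynomial.sum_comp, mul_comp, C_comp, X_pow_comp, ← pow_mul, sub_pow_char_pow,
    mul_sub, Finset.sum_sub_distrib]

theorem derivative_of_additive {K : Type*} [Field K] {q : ℕ} (hq : (q : K) = 0)
    (m : ℕ) (ω : ℕ → K) :
    derivative (∑ i ∈ Finset.range (m + 1), C (ω i) * X ^ q ^ i : K[X]) = C (ω 0) := by
  rw [derivative_sum, Finset.sum_range_succ', Finset.sum_eq_zero]
  · simp
  · intro i _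
    simp [derivative_X_pow, hq]

/-- The solutions of the differential equation have degree at most `N`, hence are finitely many. -/
theorem finite_setOf_comp_eq {K : Type*} [Field K] [Finite K] {A : K[X]} (hA : 2 ≤ A.natDegree)
    {N : ℕ} (hN : 1 ≤ N) :
    {f : K[X] | ∃ θ : K, θ ≠ 0 ∧ A.comp f = C θ * ((X ^ N - X) * derivative f)}.Finite := by
  have : Finite (degreeLT K (N + 1)) :=
    Finite.of_equiv _ (degreeLTEquiv K (N + 1)).symm.toEquiv
  refine Set.Finite.subset (Set.toFinite (degreeLT K (N + 1) : Set K[X])) ?_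
  rintro f ⟨θ, hθ, h⟩
  have h1 : (X ^ N - X : K[X]).natDegree ≤ N :=
    (natDegree_sub_le _ _).trans (by simp [hN])
  have h2 := congrArg natDegree h
  rw [natDegree_comp, natDegree_C_mul hθ] at h2
  have h3 := natDegree_mul_le (p := (X ^ N - X : K[X])) (q := derivative f)
  have h4 := natDegree_derivative_le f
  have h5 : 2 * f.natDegree ≤ f.natDegree * A.natDegree := by
    rw [mul_comm]
    exact Nat.mul_le_mul_left _ hA
  rw [SetLike.mem_coe, mem_degreeLT]
  refine lt_of_le_of_lt degree_le_natDegree ?_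
  rw [mul_comm] at h2
  exact_mod_cast (by omega : f.natDegree < N + 1)

theorem card_filter_comp_eq_le {K : Type*} [Field K] [DecidableEq K[X]] {B : K[X]}
    (hB : B.natDegree ≠ 0) (s : Finset K[X]) (h : K[X]) :
    {f ∈ s | B.comp f = h}.card ≤ B.natDegree := by
  set G : K[X][X] := B.map C - C h with hG
  have hdeg : G.natDegree = B.natDegree := by
    rw [hG, natDegree_sub_C, natDegree_map_eq_of_injective C_injective]
  have hG0 : G ≠ 0 := by
    rintro h0
    rw [h0, natDegree_zero] at hdeg
    exact hB hdeg.symm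
  rw [← hdeg]
  refine le_trans ?_ ((Multiset.toFinset_card_le _).trans (card_roots' G))
  refine Finset.card_le_card fun f hf => ?_
  rw [Multiset.mem_toFinset, mem_roots hG0, IsRoot.def, hG, eval_sub, eval_map, eval_C,
    sub_eq_zero]
  exact (Finset.mem_filter.1 hf).2

/-- The lower bound, for a divisor `A` which becomes a divisor of `X ^ Q - X` after rescaling the
variable. -/
theorem card_le_mul_ncard_of_comp_eq {K : Type*} [Field K] [Fintype K] {p r k N : ℕ}
    [Fact p.Prime] [CharP K p] (hr : r ≠ 0) (hN : N = (p ^ r) ^ (k + 1))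
    (hK : Fintype.card K = N)
    {F : Finset K} (hF : ∀ x, x ∈ F ↔ x ^ p ^ r = x) (hcard : F.card = p ^ r)
    {A B : K[X]} (hA : 2 ≤ A.natDegree) (hB : B.natDegree ≠ 0) {b u : K} (hb : b ≠ 0) (hu : u ≠ 0)
    (hBder : derivative B = C b) (hAB : A.comp B = C u * (X ^ p ^ r - X)) :
    (p ^ r) ^ 2 ^ (k + 1) ≤ B.natDegree *
      {f : K[X] | ∃ θ : K, θ ≠ 0 ∧ A.comp f = C θ * ((X ^ N - X) * derivative f)}.ncard := by
  classical
  have hQ : 1 < p ^ r := Nat.one_lt_pow hr (Fact.out : p.Prime).one_lt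
  have h1 := card_pow_le_card_twisted_fixed hr k.succ_ne_zero (hK.trans hN) hF hcard (wordShift k)
    (wordShift_pow k)
  set S := {c : (Fin (k + 1) → Fin 2) → K | ∀ s, c (wordShift k s) = c s ^ p ^ r} with hS
  rw [← Set.ncard_image_of_injective S (wordPolynomial_injective hQ (k + 1)),
    Set.ncard_eq_toFinset_card'] at h1
  set T := (Set.image (wordPolynomial (p ^ r)) S).toFinset
  have h2 := Finset.card_le_mul_card_image (f := fun f => B.comp f) T B.natDegree
    fun h _ => card_filter_comp_eq_le hB T h
  have hN1 : 1 ≤ N := hN ▸ Nat.one_le_pow _ _ (by omega)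
  have h3 : (T.image fun f => B.comp f).card ≤
      {f : K[X] | ∃ θ : K, θ ≠ 0 ∧ A.comp f = C θ * ((X ^ N - X) * derivative f)}.ncard := by
    rw [← Set.ncard_coe_finset]
    refine Set.ncard_le_ncard ?_ (finite_setOf_comp_eq hA hN1)
    intro g hg
    obtain ⟨f, hf, rfl⟩ := Finset.mem_image.1 (Finset.mem_coe.1 hg)
    obtain ⟨c, hc, rfl⟩ := Set.mem_toFinset.1 hf
    refine ⟨u * b⁻¹, mul_ne_zero hu (inv_ne_zero hb), ?_⟩
    have hbb : (C b⁻¹ * C b : K[X]) = 1 := by rw [← C_mul, inv_mul_cancel₀ hb, C_1]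
    rw [← comp_assoc, hAB, derivative_comp, hBder, C_comp, mul_comp, C_comp, sub_comp, X_pow_comp,
      X_comp, wordPolynomial_pow_sub hr hc, hN, C_mul]
    linear_combination (-C u * (X ^ (p ^ r) ^ (k + 1) - X) *
      derivative (wordPolynomial (p ^ r) c)) * hbb
  have hcardι : Fintype.card (Fin (k + 1) → Fin 2) = 2 ^ (k + 1) := by simp
  rw [← hcardι]
  exact h1.trans (h2.trans (Nat.mul_le_mul_left _ h3))

/-- Let `K` have `q^n` elements, `d` a positive divisor of `n`, and
`A` a monic `q`-additive polynomial of degree `q^t` satisfying (*). If `α ≠ 0`,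
`X^{q^d} − αX` satisfies (*) and `A` divides `X^{q^d} − αX`, then
`|W(A|K)| ≥ q^{d·2^{n/d} − d + t}`. -/
theorem stmt17 (q n d t : ℕ) (hq : IsPrimePow q) (hn : 1 ≤ n)
    (hd : 0 < d) (hdn : d ∣ n)
    {K : Type*} [Field K] [Fintype K] (hK : Fintype.card K = q ^ n)
    (A : K[X])
    (hAq : ∃ (m : ℕ) (ω : ℕ → K),
      A = ∑ i ∈ Finset.range (m + 1), C (ω i) * X ^ q ^ i)
    (hAmonic : A.Monic) (hAdeg : A.natDegree = q ^ t)
    (hAstar : 2 < A.natDegree ∧ Multiset.card A.roots = A.natDegree ∧ A.roots.Nodup)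
    (α : K) (hα : α ≠ 0)
    (hstar : (X ^ q ^ d - C α * X : K[X]).Monic ∧
      2 < (X ^ q ^ d - C α * X : K[X]).natDegree ∧
      Multiset.card (X ^ q ^ d - C α * X : K[X]).roots =
        (X ^ q ^ d - C α * X : K[X]).natDegree ∧
      (X ^ q ^ d - C α * X : K[X]).roots.Nodup)
    (hdvd : A ∣ X ^ q ^ d - C α * X) :
    q ^ (d * 2 ^ (n / d) - d + t) ≤
      {f : K[X] | ∃ θ : K, θ ≠ 0 ∧
        A.comp f = C θ * ((X ^ q ^ n - X) * f.derivative)}.ncard := by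
  classical
  obtain ⟨p, k, hp, hk, rfl⟩ := (isPrimePow_nat_iff q).1 hq
  have : Fact p.Prime := ⟨hp⟩
  have : CharP K p := charP_of_card_eq_prime_pow (f := k * n) (by rw [hK, pow_mul])
  obtain ⟨m, ω, hAω⟩ := hAq
  have hqK : ((p ^ k : ℕ) : K) = 0 := by simp [hk.ne']
  have hadd : ∀ f g : K[X], A.comp (f - g) = A.comp f - A.comp g := by
    intro f g
    rw [hAω, comp_sub_of_additive]
  have hder : derivative A = C (ω 0) := by rw [hAω, derivative_of_additive hqK]
  have hr : k * d ≠ 0 := (Nat.mul_pos hk hd).ne'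
  have hQ : (p ^ k) ^ d = p ^ (k * d) := (pow_mul p k d).symm
  rw [hQ] at hstar hdvd
  set Q := p ^ (k * d) with hQdef
  have hQ1 : 1 < Q := Nat.one_lt_pow hr hp.one_lt
  set L : K[X] := X ^ Q - C α * X with hL
  have hLdeg : L.natDegree = Q := by
    rw [hL, natDegree_sub_eq_left_of_natDegree_lt] <;> simp [hα, hQ1]
  obtain ⟨hLmonic, hL2, hLcard, hLnodup⟩ := hstar
  have hLroot : ∀ x, x ∈ L.roots.toFinset ↔ x ^ Q = α * x := by
    intro x
    rw [Multiset.mem_toFinset, mem_roots hLmonic.ne_zero]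
    simp [hL, sub_eq_zero]
  have hLF : L.roots.toFinset.card = Q := by
    rw [Multiset.toFinset_card_of_nodup hLnodup, hLcard, hLdeg]
  obtain ⟨β, hβL, hβ⟩ := Finset.exists_mem_ne (hLF ▸ hQ1) (0 : K)
  have hβQ : β ^ Q = α * β := (hLroot β).1 hβL
  set F : Finset K := Finset.univ.filter fun x => x ^ Q = x with hFdef
  have hF : ∀ x, x ∈ F ↔ x ^ Q = x := by simp [hFdef]
  have hFcard : F.card = Q := by
    rw [← hLF, ← Finset.card_image_of_injective F (mul_right_injective₀ hβ)]
    congr 1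
    ext x
    rw [Finset.mem_image, hLroot]
    constructor
    · rintro ⟨y, hy, rfl⟩
      rw [mul_pow, hβQ, (hF y).1 hy, mul_assoc]
    · intro hx
      refine ⟨β⁻¹ * x, (hF _).2 ?_, by rw [mul_inv_cancel_left₀ hβ]⟩
      rw [mul_pow, inv_pow, hβQ, hx]
      field_simp
  set v : K := β ^ A.natDegree with hv
  have hv0 : v ≠ 0 := pow_ne_zero _ hβ
  set A' : K[X] := C v⁻¹ * A.comp (C β * X) with hA'
  have hβX : (C β * X : K[X]).natDegree = 1 := natDegree_C_mul_X β hβ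
  have hA'deg : A'.natDegree = A.natDegree := by
    rw [hA', natDegree_C_mul (inv_ne_zero hv0), natDegree_comp, hβX, mul_one]
  have hA'monic : A'.Monic := by
    rw [Monic, hA', leadingCoeff_mul, leadingCoeff_C, leadingCoeff_comp (by rw [hβX]; simp),
      hAmonic.leadingCoeff, one_mul, leadingCoeff_C_mul_X, inv_mul_cancel₀ hv0]
  have hA'add : ∀ f g : K[X], A'.comp (f - g) = A'.comp f - A'.comp g := by
    intro f g
    simp only [hA', mul_comp, C_comp, comp_assoc, X_comp, mul_sub, hadd]
  have hA'der : derivative A' = C (v⁻¹ * (β * ω 0)) := by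
    rw [hA', derivative_C_mul, derivative_comp, hder]
    simp
  have hA'dvd : A' ∣ X ^ Q - X := by
    have h1 := map_dvd (compRingHom (C β * X)) hdvd
    have h2 : (C β : K[X]) ^ Q = C α * C β := by rw [← C_pow, hβQ, C_mul]
    have h3 : L.comp (C β * X) = C (α * β) * (X ^ Q - X) := by
      simp only [hL, sub_comp, X_pow_comp, mul_comp, C_comp, X_comp, mul_pow, h2, C_mul]
      ring
    rw [coe_compRingHom_apply, coe_compRingHom_apply, h3] at h1
    rw [hA']
    exact (isUnit_C.2 (inv_ne_zero hv0).isUnit).mul_left_dvd.2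
      ((isUnit_C.2 (mul_ne_zero hα hβ).isUnit).dvd_mul_left.1 h1)
  obtain ⟨B, b, hBdeg, hb, hBder, hAB⟩ := exists_comp_eq_X_pow_sub_X hr hF hFcard hA'monic
    (by omega) hA'add hA'der hA'dvd
  have hABβ : A.comp (C β * B) = C v * (X ^ Q - X) := by
    have hvv : (C v * C v⁻¹ : K[X]) = 1 := by rw [← C_mul, mul_inv_cancel₀ hv0, C_1]
    rw [← hAB, hA', mul_comp, C_comp, comp_assoc, mul_comp, C_comp, X_comp, ← mul_assoc, hvv,
      one_mul]
  have hBβ : (C β * B).natDegree = B.natDegree := natDegree_C_mul hβ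
  have hB0 : B.natDegree ≠ 0 := by
    intro h0
    rw [h0, zero_mul] at hBdeg
    omega
  obtain ⟨l, hl⟩ : ∃ l, n / d = l + 1 :=
    Nat.exists_eq_succ_of_ne_zero (Nat.div_pos (Nat.le_of_dvd hn hdn) hd).ne'
  have hnl : n = d * (l + 1) := by rw [← hl, Nat.mul_div_cancel' hdn]
  have hmain := card_le_mul_ncard_of_comp_eq hr (N := (p ^ k) ^ n) (k := l)
    (by rw [hnl, pow_mul, hQ]) hK hF hFcard (A := A) (B := C β * B) (by omega) (hBβ ▸ hB0)
    (mul_ne_zero hβ hb) hv0 (by rw [derivative_C_mul, hBder, C_mul]) hABβ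
  rw [hBβ, ← hQdef] at hmain
  have hq1 : 1 < p ^ k := Nat.one_lt_pow hk.ne' hp.one_lt
  rw [hA'deg, hAdeg, ← hQdef, ← hQ] at hBdeg
  have htd : t ≤ d := (Nat.pow_dvd_pow_iff_le_right hq1).1 (Dvd.intro_left _ hBdeg)
  refine Nat.le_of_mul_le_mul_left (c := B.natDegree) ?_ (Nat.pos_of_ne_zero hB0)
  refine le_trans (le_of_eq ?_) hmain
  refine Nat.eq_of_mul_eq_mul_right (pow_pos (by omega : 0 < p ^ k) t) ?_
  have hd2 : d ≤ d * 2 ^ (l + 1) := Nat.le_mul_of_pos_right _ (by positivity)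
  rw [mul_right_comm, hBdeg, hl, ← hQ, ← pow_mul (p ^ k) d, ← pow_add, ← pow_add]
  congr 1
  omega
end

section
/- Let K be a finite field with q^n elements, let d be a positive divisor of n, and let A ∈ K[X] be a monic q-additive polynomial of degree q^t satisfying (*), with 2t ≥ n (i.e. deg A = q^t ≥ q^{n/2}). Suppose α ∈ K is nonzero, X^{q^d} − α·X satisfies (*), A divides X^{q^d} − α·X, and d is minimal with this property: for every positive integer d′ and every nonzero α′ ∈ K such that X^{q^{d′}} − α′·X satisfies (*) and A divides X^{q^{d′}} − α′·X, one has d ≤ d′. Then |W(A|K)| = q^{d·2^{n/d} − d + t}. -/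
open Polynomial

/-- `A` induces an additive map under composition. -/
def CompAdditive {K : Type*} [Field K] (A : K[X]) : Prop :=
  ∀ g h : K[X], A.comp (g + h) = A.comp g + A.comp h

namespace CompAdditive

variable {K : Type*} [Field K] {A : K[X]}

lemma comp_sub (hA : CompAdditive A) (g h : K[X]) :
    A.comp (g - h) = A.comp g - A.comp h := by
  have := hA (g - h) h
  rw [sub_add_cancel] at this
  rw [this, add_sub_cancel_right]

lemma eval_add' (hA : CompAdditive A) (x y : K) :
    A.eval (x + y) = A.eval x + A.eval y := by
  have := congrArg (eval 0) (hA (C x) (C y))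
  simpa using this

lemma eval_zero' (hA : CompAdditive A) : A.eval 0 = 0 := by
  simpa using hA.eval_add' 0 0

lemma card_root_subtype (hm : A.Monic)
    (hcard : Multiset.card A.roots = A.natDegree) (hnd : A.roots.Nodup) :
    Nat.card {v : K // A.eval v = 0} = A.natDegree := by
  classical
  rw [← hcard, ← Multiset.toFinset_card_of_nodup hnd, ← Nat.card_eq_finsetCard]
  refine Nat.card_congr (Equiv.subtypeEquivRight fun x => ?_)
  simp [hm.ne_zero]

/-- Evaluation of `A` as an additive endomorphism of `K`. -/
def evalHom (hA : CompAdditive A) : K →+ K where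
  toFun x := A.eval x
  map_zero' := hA.eval_zero'
  map_add' := hA.eval_add'

/-- Two preimages of the same polynomial differ by a root of `A`. -/
lemma exists_eq_add_C (hA : CompAdditive A) (hA0 : A ≠ 0) {f g : K[X]}
    (h : A.comp f = A.comp g) : ∃ v, A.eval v = 0 ∧ f = g + C v := by
  have h0 : A.comp (f - g) = 0 := by rw [hA.comp_sub, h, sub_self]
  rcases comp_eq_zero_iff.1 h0 with h1 | ⟨h1, h2⟩
  · exact absurd h1 hA0
  · exact ⟨_, h1, by rw [← h2]; ring⟩

variable [Fintype K]

lemma comp_X_pow_card_sub_X (hA : CompAdditive A) :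
    A.comp (X ^ Fintype.card K - X) = (X ^ Fintype.card K - X : K[X]).comp A := by
  rw [hA.comp_sub, comp_X, ← expand_eq_comp_X_pow, FiniteField.expand_card]
  simp

/-- The polynomial whose roots are the values of `A` is a left compositional cofactor of
`X ^ |K| - X`. -/
lemma exists_comp_left (hA : CompAdditive A) (hm : A.Monic) (hdeg : 2 < A.natDegree)
    (hcard : Multiset.card A.roots = A.natDegree) (hnd : A.roots.Nodup) :
    ∃ B : K[X], B.Monic ∧ A.natDegree * B.natDegree = Fintype.card K ∧
      B.comp A = X ^ Fintype.card K - X := by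
  classical
  set U : Finset K := Finset.univ.image (fun x => A.eval x) with hU
  have hker : Nat.card hA.evalHom.ker = A.natDegree := card_root_subtype hm hcard hnd
  have hrange : Nat.card hA.evalHom.range = U.card := by
    rw [← Nat.card_eq_finsetCard]
    refine Nat.card_congr (Equiv.subtypeEquivRight fun x => ?_)
    simp [hU, evalHom]
  have hprod : A.natDegree * U.card = Fintype.card K := by
    rw [← hker, ← hrange, ← AddSubgroup.index_ker, AddSubgroup.card_mul_index,
      Nat.card_eq_fintype_card]
  have hB : (∏ u ∈ U, (X - C u)).Monic := monic_prod_of_monic _ _ fun u _ => monic_X_sub_C u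
  have hBdeg : (∏ u ∈ U, (X - C u)).natDegree = U.card :=
    natDegree_finsetProd_X_sub_C_eq_card U fun u => u
  refine ⟨∏ u ∈ U, (X - C u), hB, by rw [hBdeg, hprod], ?_⟩
  have hPm : (X ^ Fintype.card K - X : K[X]).Monic :=
    monic_X_pow_sub (by rw [degree_X]; exact_mod_cast Fintype.one_lt_card)
  have hPd := FiniteField.X_pow_card_sub_X_natDegree_eq K (Fintype.one_lt_card (α := K))
  have hcm : ((∏ u ∈ U, (X - C u)).comp A).Monic := hB.comp hm (by omega)
  have hcd : ((∏ u ∈ U, (X - C u)).comp A).natDegree = Fintype.card K := by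
    rw [natDegree_comp, hBdeg, mul_comm, hprod]
  refine eq_of_degree_sub_lt_of_eval_finset_eq Finset.univ ?_ ?_
  · have hde : ((∏ u ∈ U, (X - C u)).comp A).degree =
        (X ^ Fintype.card K - X : K[X]).degree := by
      rw [degree_eq_natDegree hcm.ne_zero, degree_eq_natDegree hPm.ne_zero, hcd, hPd]
    have := degree_sub_lt_left hde hcm.ne_zero (by rw [hcm.leadingCoeff, hPm.leadingCoeff])
    rwa [degree_eq_natDegree hcm.ne_zero, hcd] at this
  · intro x _
    rw [eval_comp, eval_prod, eval_sub, eval_pow, eval_X, FiniteField.pow_card, sub_self]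
    exact Finset.prod_eq_zero (i := A.eval x) (by simp [hU]) (by simp)

/-- A left compositional cofactor of `X ^ |K| - X` is also a right one. -/
lemma comp_right_of_comp_left (hA : CompAdditive A) (hdeg : A.natDegree ≠ 0) {B : K[X]}
    (hB : B.comp A = X ^ Fintype.card K - X) : A.comp B = X ^ Fintype.card K - X := by
  have h : (A.comp B - (X ^ Fintype.card K - X)).comp A = 0 := by
    rw [Polynomial.sub_comp, comp_assoc, hB, hA.comp_X_pow_card_sub_X, sub_self]
  rcases comp_eq_zero_iff.1 h with h1 | ⟨-, h2⟩
  · exact sub_eq_zero.1 h1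
  · exact absurd (by rw [h2, natDegree_C]) hdeg

end CompAdditive

section Solutions

variable {K : Type*} [Field K] {A B f : K[X]} {a₀ θ : K}

lemma derivative_comp_C_mul_X (hB' : derivative B = C (-a₀⁻¹)) (γ : K) :
    derivative (B.comp (C γ * X)) = C (-(γ * a₀⁻¹)) := by
  rw [derivative_comp, hB', C_comp, derivative_C_mul, derivative_X, mul_one, ← C_mul, mul_neg]

lemma coeff_pow_eq_zero_of_not_dvd {p e : ℕ} [Fact p.Prime] [CharP K p] (f : K[X]) {m : ℕ}
    (hm : ¬ p ^ e ∣ m) :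
    (f ^ p ^ e).coeff m = 0 := by
  rw [← map_iterateFrobenius_expand p f e, coeff_map,
    coeff_expand (pow_pos (Fact.out : p.Prime).pos e), if_neg hm, map_zero]

variable [Fintype K]

lemma derivative_X_pow_card_sub_X :
    derivative (X ^ Fintype.card K - X : K[X]) = -1 := by
  simp [derivative_X_pow]

lemma derivative_right_factor (hA' : derivative A = C a₀)
    (hAB : A.comp B = X ^ Fintype.card K - X) :
    a₀ ≠ 0 ∧ derivative B = C (-a₀⁻¹) := by
  have h := congrArg derivative hAB
  rw [derivative_comp, hA', C_comp, derivative_X_pow_card_sub_X] at h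
  have h0 : a₀ ≠ 0 := by
    rintro rfl
    simp at h
  refine ⟨h0, mul_right_cancel₀ (C_ne_zero.2 h0) ?_⟩
  rw [h, ← C_mul, neg_mul, inv_mul_cancel₀ h0, C_neg, C_1]

lemma comp_comp_C_mul_X (hAB : A.comp B = X ^ Fintype.card K - X) (γ : K) :
    A.comp (B.comp (C γ * X)) = C γ * (X ^ Fintype.card K - X) := by
  rw [← comp_assoc, hAB]
  simp only [Polynomial.sub_comp, X_pow_comp, X_comp, mul_pow, ← C_pow, FiniteField.pow_card]
  ring

lemma eq_neg_of_derivative_derivative_eq_zero (hA' : derivative A = C a₀)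
    (hf : A.comp f = C θ * ((X ^ Fintype.card K - X) * derivative f))
    (h2 : derivative (derivative f) = 0) (h1 : derivative f ≠ 0) : θ = -a₀ := by
  have h := congrArg derivative hf
  rw [derivative_comp, hA', C_comp, derivative_C_mul, derivative_mul,
    derivative_X_pow_card_sub_X, h2] at h
  have h3 : (C (a₀ + θ) : K[X]) * derivative f = 0 := by
    rw [C_add]
    linear_combination h
  rcases mul_eq_zero.1 h3 with h4 | h4
  · linear_combination C_eq_zero.1 h4
  · exact absurd h4 h1

lemma natDegree_cases {Q r : ℕ} (hQ : A.natDegree = Q) (hQ2 : 2 < Q) (hr : r ≤ Q)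
    (hN : Q * r = Fintype.card K) (hθ : θ ≠ 0)
    (hf : A.comp f = C θ * ((X ^ Fintype.card K - X) * derivative f))
    (h1 : derivative f ≠ 0) :
    (derivative f).natDegree = 0 ∨
      (r = Q ∧ (derivative f).natDegree = Q ∧ f.natDegree = Q + 1) := by
  have hd := congrArg natDegree hf
  rw [natDegree_comp, natDegree_C_mul hθ,
    natDegree_mul (FiniteField.X_pow_card_sub_X_ne_zero K Fintype.one_lt_card) h1,
    FiniteField.X_pow_card_sub_X_natDegree_eq K Fintype.one_lt_card, hQ, ← hN] at hd
  have hf0 : f.natDegree ≠ 0 := fun h => h1 (by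
    rw [eq_C_of_natDegree_eq_zero h, derivative_C])
  have hlt := natDegree_derivative_lt hf0
  generalize (derivative f).natDegree = e at *
  generalize f.natDegree = D at *
  have hrD : r ≤ D := Nat.le_of_mul_le_mul_left (by omega : Q * r ≤ Q * D) (by omega)
  obtain ⟨s, rfl⟩ := Nat.exists_eq_add_of_le hrD
  have he : e = Q * s := by rw [mul_add] at hd; omega
  subst he
  rcases Nat.lt_or_ge s 2 with hs | hs
  · interval_cases s <;> omega
  · exfalso
    nlinarith

lemma comp_C_mul_X_pow_of_binomial {Q : ℕ} {a : K} (hN : Q * Q = Fintype.card K)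
    (ha : a ^ Q = -a₀ * a) (hA : A = X ^ Q + C a₀ * X) :
    A.comp (C a * X ^ (Q + 1)) =
      C (-a₀) * ((X ^ Fintype.card K - X) * (C a * X ^ Q)) := by
  rw [hA, ← hN]
  simp only [Polynomial.add_comp, X_pow_comp, mul_comp, C_comp, X_comp]
  rw [mul_pow, ← C_pow, ha]
  simp only [C_mul, C_neg]
  ring

/-- In the exceptional case `A` is a binomial. -/
lemma eq_binomial_of_comp_add {Q : ℕ} {a : K} {g : K[X]} (hA : CompAdditive A)
    (hQ2 : 2 < Q) (hAQ : A.natDegree = Q)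
    (hlow : (A - X ^ Q).natDegree * 2 ≤ Q) (hN : Q * Q = Fintype.card K)
    (hg : g.natDegree ≤ Q) (ha : a ≠ 0)
    (h : A.comp (C a * X ^ (Q + 1)) + A.comp g =
      C (-a₀) * ((X ^ Fintype.card K - X) * (C a * X ^ Q))) :
    a ^ Q = -a₀ * a ∧ A = X ^ Q + C a₀ * X := by
  set A₁ : K[X] := A - X ^ Q - C a₀ * X with hA₁
  have hA₁deg : A₁.natDegree < Q := by
    refine lt_of_le_of_lt (natDegree_sub_le _ _) (max_lt (by omega) ?_)
    exact lt_of_le_of_lt (natDegree_C_mul_le _ _) (by rw [natDegree_X]; omega)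
  have hAeq : A = X ^ Q + C a₀ * X + A₁ := by rw [hA₁]; ring
  have key : A.comp g + A₁.comp (C a * X ^ (Q + 1)) =
      C (-a₀ * a - a ^ Q) * X ^ (Q * Q + Q) := by
    have h1 : A.comp (C a * X ^ (Q + 1)) = C (a ^ Q) * X ^ (Q * Q + Q) +
        C (a₀ * a) * X ^ (Q + 1) + A₁.comp (C a * X ^ (Q + 1)) := by
      conv_lhs => rw [hAeq]
      simp only [Polynomial.add_comp, X_pow_comp, mul_comp, C_comp, X_comp, C_mul, C_pow]
      ring
    rw [h1, ← hN] at h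
    simp only [C_mul, C_neg, C_pow, C_sub] at h ⊢
    linear_combination h
  have hdl : (A.comp g + A₁.comp (C a * X ^ (Q + 1))).natDegree < Q * Q + Q := by
    refine lt_of_le_of_lt (natDegree_add_le _ _) (max_lt ?_ ?_)
    · rw [natDegree_comp, hAQ]
      nlinarith
    · rw [natDegree_comp, natDegree_C_mul_X_pow _ _ ha]
      nlinarith
  have hz : -a₀ * a - a ^ Q = 0 := by
    have := coeff_eq_zero_of_natDegree_lt hdl
    rwa [key, coeff_C_mul_X_pow, if_pos rfl] at this
  refine ⟨(sub_eq_zero.1 hz).symm, ?_⟩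
  rw [hz, C_0, zero_mul] at key
  have hdeq : Q * g.natDegree = A₁.natDegree * (Q + 1) := by
    have := congrArg natDegree (eq_neg_of_add_eq_zero_left key)
    rwa [natDegree_neg, natDegree_comp, natDegree_comp, hAQ, natDegree_C_mul_X_pow _ _ ha]
      at this
  have hdv : Q ∣ A₁.natDegree :=
    (Nat.Coprime.dvd_mul_right (by simp)).1 (Dvd.intro _ hdeq)
  have hA₁0 : A₁.natDegree = 0 := Nat.eq_zero_of_dvd_of_lt hdv hA₁deg
  have hA₁z : A₁ = 0 := by
    rw [eq_C_of_natDegree_eq_zero hA₁0, coeff_zero_eq_eval_zero, hA₁]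
    simp [hA.eval_zero', show Q ≠ 0 by omega]
  rw [hAeq, hA₁z, add_zero]

variable {p e : ℕ} [Fact p.Prime] [CharP K p]

/-- The shape of `f'` in the exceptional case `|K| = Q ^ 2`, `deg f = Q + 1`. -/
lemma derivative_eq_of_natDegree {Q : ℕ} (hQe : Q = p ^ e) (hQ2 : 2 < Q)
    (hlow : (A - X ^ Q).natDegree * 2 ≤ Q)
    (hN : Q * Q = Fintype.card K) (hθ : θ ≠ 0)
    (hf : A.comp f = C θ * ((X ^ Fintype.card K - X) * derivative f))
    (hdeg' : (derivative f).natDegree = Q) (hdeg : f.natDegree = Q + 1) :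
    derivative f = C (f.coeff (Q + 1)) * X ^ Q + C ((derivative f).coeff 0) := by
  have hQ0 : (Q : K) = 0 := by
    have : e ≠ 0 := by rintro rfl; simp at hQe; omega
    rw [hQe, Nat.cast_pow, CharP.cast_eq_zero, zero_pow this]
  ext i
  rw [coeff_add, coeff_C_mul_X_pow, coeff_C]
  rcases lt_trichotomy i Q with hi | rfl | hi
  · rcases Nat.eq_zero_or_pos i with rfl | hi0
    · simp [show ¬ 0 = Q by omega]
    · rw [if_neg hi.ne, if_neg hi0.ne', add_zero]
      have hsplit : A.comp f = f ^ Q + (A - X ^ Q).comp f := by simp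
      have hc := congrArg (coeff · (Q * Q + i)) hf
      simp only [hsplit, coeff_add, coeff_C_mul, sub_mul, coeff_sub] at hc
      have h1 : (f ^ Q).coeff (Q * Q + i) = 0 := by
        rw [hQe]
        apply coeff_pow_eq_zero_of_not_dvd
        rw [← hQe]
        intro hdv
        have := Nat.le_of_dvd hi0 ((Nat.dvd_add_right (Dvd.intro _ rfl)).1 hdv)
        omega
      have h2 : ((A - X ^ Q).comp f).coeff (Q * Q + i) = 0 := by
        apply coeff_eq_zero_of_natDegree_lt
        rw [natDegree_comp, hdeg]
        nlinarith
      have h3 : (X * derivative f).coeff (Q * Q + i) = 0 := by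
        apply coeff_eq_zero_of_natDegree_lt
        refine lt_of_le_of_lt natDegree_mul_le ?_
        rw [natDegree_X, hdeg']
        nlinarith
      rw [h1, h2, h3, ← hN, add_comm (Q * Q) i, coeff_X_pow_mul, add_zero, sub_zero] at hc
      exact (mul_eq_zero.1 hc.symm).resolve_left hθ
  · rw [if_pos rfl, if_neg (by omega), coeff_derivative, hQ0]
    ring
  · rw [if_neg hi.ne', if_neg (by omega), coeff_eq_zero_of_natDegree_lt (by omega), add_zero]

/-- Classification of the solutions of `A ∘ f = θ (X ^ |K| - X) f'`. -/
lemma solution_cases {Q : ℕ} (hA : CompAdditive A) (hA' : derivative A = C a₀)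
    (hQe : Q = p ^ e) (hQ2 : 2 < Q) (hAQ : A.natDegree = Q)
    (hlow : (A - X ^ Q).natDegree * 2 ≤ Q) (hBQ : B.natDegree ≤ Q)
    (hN : Q * B.natDegree = Fintype.card K) (hAB : A.comp B = X ^ Fintype.card K - X)
    (hθ : θ ≠ 0) (hf : A.comp f = C θ * ((X ^ Fintype.card K - X) * derivative f)) :
    (∃ γ v, A.eval v = 0 ∧ f = B.comp (C γ * X) + C v) ∨
      ∃ γ v a, B.natDegree = Q ∧ A.eval v = 0 ∧ a ^ Q = -a₀ * a ∧ A = X ^ Q + C a₀ * X ∧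
        f = B.comp (C γ * X) + C a * X ^ (Q + 1) + C v := by
  have hA0 : A ≠ 0 := by rintro rfl; simp at hAQ; omega
  by_cases h1 : derivative f = 0
  · left
    refine ⟨0, ?_⟩
    have h2 : A.comp f = A.comp (B.comp (C 0 * X)) := by
      rw [comp_comp_C_mul_X hAB, hf, h1]
      simp
    exact hA.exists_eq_add_C hA0 h2
  rcases natDegree_cases hAQ hQ2 hBQ hN hθ hf h1 with h0 | ⟨hBQ', hd', hd⟩
  · left
    rw [natDegree_eq_zero] at h0
    obtain ⟨b, hb⟩ := h0
    have hθ' := eq_neg_of_derivative_derivative_eq_zero hA' hf (by rw [← hb, derivative_C]) h1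
    refine ⟨-a₀ * b, hA.exists_eq_add_C hA0 ?_⟩
    rw [comp_comp_C_mul_X hAB, hf, ← hb, hθ', C_mul]
    ring
  · right
    rw [hBQ'] at hN
    have hshape := derivative_eq_of_natDegree hQe hQ2 hlow hN hθ hf hd' hd
    set a := f.coeff (Q + 1)
    set b := (derivative f).coeff 0
    have ha : a ≠ 0 := by
      have : f.leadingCoeff ≠ 0 := leadingCoeff_ne_zero.2 (by rintro rfl; simp at hd)
      rwa [leadingCoeff, hd] at this
    have hQ0 : (Q : K) = 0 := by
      have : e ≠ 0 := by rintro rfl; simp at hQe; omega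
      rw [hQe, Nat.cast_pow, CharP.cast_eq_zero, zero_pow this]
    have hθ' := eq_neg_of_derivative_derivative_eq_zero hA' hf
      (by rw [hshape]; simp [derivative_X_pow, hQ0]) h1
    set F := B.comp (C (-a₀ * b) * X) with hF
    have hFd : F.natDegree ≤ Q := by
      rw [hF, natDegree_comp, hBQ']
      have := natDegree_C_mul_le (-a₀ * b) X
      rw [natDegree_X] at this
      nlinarith
    have hAF : A.comp F = C (-a₀ * b) * (X ^ Fintype.card K - X) := comp_comp_C_mul_X hAB _
    set g := f - F - C a * X ^ (Q + 1) with hg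
    have hgd : g.natDegree ≤ Q := by
      rw [natDegree_le_iff_coeff_eq_zero]
      intro m hm
      rw [hg, coeff_sub, coeff_sub, coeff_C_mul_X_pow,
        coeff_eq_zero_of_natDegree_lt (lt_of_le_of_lt hFd hm)]
      split_ifs with hm'
      · rw [hm']; simp [a]
      · rw [coeff_eq_zero_of_natDegree_lt (by omega)]; simp
    have hsum : A.comp (C a * X ^ (Q + 1)) + A.comp g =
        C (-a₀) * ((X ^ Fintype.card K - X) * (C a * X ^ Q)) := by
      rw [← hA, hg, show C a * X ^ (Q + 1) + (f - F - C a * X ^ (Q + 1)) = f - F by ring,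
        hA.comp_sub, hAF, hf, hshape, hθ', C_mul]
      ring
    obtain ⟨haQ, hAbin⟩ := eq_binomial_of_comp_add hA hQ2 hAQ hlow hN hgd ha hsum
    have hfeq : A.comp f = A.comp (F + C a * X ^ (Q + 1)) := by
      rw [hA, hAF, hf, hshape, hθ', comp_C_mul_X_pow_of_binomial hN haQ hAbin, C_mul]
      ring
    obtain ⟨v, hv, hfv⟩ := hA.exists_eq_add_C hA0 hfeq
    exact ⟨_, v, a, hBQ', hv, haQ, hAbin, hfv⟩

lemma linear_solution (hA : CompAdditive A) (hA' : derivative A = C a₀)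
    (hAB : A.comp B = X ^ Fintype.card K - X) (γ : K) {v : K} (hv : A.eval v = 0) :
    A.comp (B.comp (C γ * X) + C v) =
      C (-a₀) * ((X ^ Fintype.card K - X) * derivative (B.comp (C γ * X) + C v)) := by
  obtain ⟨ha₀, hB'⟩ := derivative_right_factor hA' hAB
  have hc : C (-a₀) * C (-(γ * a₀⁻¹)) = C γ := by
    rw [← C_mul]
    congr 1
    field_simp
  rw [hA, comp_comp_C_mul_X hAB, comp_C, hv, derivative_add, derivative_C,
    derivative_comp_C_mul_X hB', ← hc, C_0]
  ring

lemma ncard_solutions_of_not_binomial {Q : ℕ} (hA : CompAdditive A)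
    (hA' : derivative A = C a₀) (hQe : Q = p ^ e) (hQ2 : 2 < Q) (hAQ : A.natDegree = Q)
    (hroots : Nat.card {v : K // A.eval v = 0} = Q)
    (hlow : (A - X ^ Q).natDegree * 2 ≤ Q) (hBQ : B.natDegree ≤ Q)
    (hN : Q * B.natDegree = Fintype.card K) (hAB : A.comp B = X ^ Fintype.card K - X)
    (hbin : B.natDegree = Q → A ≠ X ^ Q + C a₀ * X) :
    {f : K[X] | ∃ θ : K, θ ≠ 0 ∧
      A.comp f = C θ * ((X ^ Fintype.card K - X) * derivative f)}.ncard =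
      Fintype.card K * Q := by
  obtain ⟨ha₀, hB'⟩ := derivative_right_factor hA' hAB
  set φ : K × {v : K // A.eval v = 0} → K[X] :=
    fun x => B.comp (C x.1 * X) + C x.2.1 with hφ
  have hinj : Function.Injective φ := by
    rintro ⟨γ, v, hv⟩ ⟨γ', v', hv'⟩ h
    have hd := congrArg derivative h
    simp only [hφ, derivative_add, derivative_C, derivative_comp_C_mul_X hB', add_zero] at hd
    have hγ : γ = γ' := by simpa [ha₀] using C_injective hd
    subst hγ
    simpa [hφ] using h
  have hset : {f : K[X] | ∃ θ : K, θ ≠ 0 ∧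
      A.comp f = C θ * ((X ^ Fintype.card K - X) * derivative f)} = Set.range φ := by
    ext f
    constructor
    · rintro ⟨θ, hθ, hf⟩
      rcases solution_cases hA hA' hQe hQ2 hAQ hlow hBQ hN hAB hθ hf with
        ⟨γ, v, hv, rfl⟩ | ⟨-, -, -, h1, -, -, h2, -⟩
      · exact ⟨⟨γ, v, hv⟩, rfl⟩
      · exact absurd h2 (hbin h1)
    · rintro ⟨⟨γ, v, hv⟩, rfl⟩
      exact ⟨-a₀, neg_ne_zero.2 ha₀, linear_solution hA hA' hAB γ hv⟩
  rw [hset, Set.ncard_range_of_injective hinj, Nat.card_prod, hroots, Nat.card_eq_fintype_card]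

lemma ncard_solutions_of_binomial {Q : ℕ} (hA : CompAdditive A)
    (hA' : derivative A = C a₀) (hQe : Q = p ^ e) (hQ2 : 2 < Q) (hAQ : A.natDegree = Q)
    (hroots : Nat.card {v : K // A.eval v = 0} = Q)
    (hlow : (A - X ^ Q).natDegree * 2 ≤ Q) (hBQ : B.natDegree = Q)
    (hN : Q * Q = Fintype.card K) (hAB : A.comp B = X ^ Fintype.card K - X)
    (hbin : A = X ^ Q + C a₀ * X) :
    {f : K[X] | ∃ θ : K, θ ≠ 0 ∧
      A.comp f = C θ * ((X ^ Fintype.card K - X) * derivative f)}.ncard =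
      Fintype.card K * (Q * Q) := by
  obtain ⟨ha₀, hB'⟩ := derivative_right_factor hA' hAB
  have hQ0 : (Q : K) = 0 := by
    have : e ≠ 0 := by rintro rfl; simp at hQe; omega
    rw [hQe, Nat.cast_pow, CharP.cast_eq_zero, zero_pow this]
  have hroot (a : K) : A.eval a = 0 ↔ a ^ Q = -a₀ * a := by
    rw [hbin, eval_add, eval_pow, eval_X, eval_C_mul, eval_X, add_eq_zero_iff_eq_neg, neg_mul]
  have hder (a : K) : derivative (C a * X ^ (Q + 1)) = C a * X ^ Q := by
    simp [hQ0]
  set φ : K × {v : K // A.eval v = 0} × {v : K // A.eval v = 0} → K[X] :=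
    fun x => B.comp (C x.1 * X) + C x.2.1.1 * X ^ (Q + 1) + C x.2.2.1 with hφ
  have hinj : Function.Injective φ := by
    rintro ⟨γ, ⟨a, ha⟩, v, hv⟩ ⟨γ', ⟨a', ha'⟩, v', hv'⟩ h
    have hd := congrArg derivative h
    simp only [hφ, derivative_add, derivative_C, derivative_comp_C_mul_X hB', add_zero,
      hder] at hd
    have h0 := congrArg (coeff · 0) hd
    have h1 := congrArg (coeff · Q) hd
    simp only [coeff_add, coeff_C_mul_X_pow, coeff_C, if_neg (show ¬ 0 = Q by omega),
      if_neg (show ¬ Q = 0 by omega), if_true, zero_add, add_zero] at h0 h1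
    have hγ : γ = γ' := by simpa [ha₀] using h0
    subst hγ
    subst h1
    simpa [hφ] using h
  have hset : {f : K[X] | ∃ θ : K, θ ≠ 0 ∧
      A.comp f = C θ * ((X ^ Fintype.card K - X) * derivative f)} = Set.range φ := by
    ext f
    constructor
    · rintro ⟨θ, hθ, hf⟩
      rcases solution_cases hA hA' hQe hQ2 hAQ hlow hBQ.le (by rw [hBQ, hN]) hAB hθ hf with
        ⟨γ, v, hv, rfl⟩ | ⟨γ, v, a, -, hv, ha, -, rfl⟩
      · exact ⟨⟨γ, ⟨0, hA.eval_zero'⟩, v, hv⟩, by simp [hφ]⟩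
      · exact ⟨⟨γ, ⟨a, (hroot a).2 ha⟩, v, hv⟩, rfl⟩
    · rintro ⟨⟨γ, ⟨a, ha⟩, v, hv⟩, rfl⟩
      refine ⟨-a₀, neg_ne_zero.2 ha₀, ?_⟩
      simp only [hφ]
      rw [add_right_comm, hA, derivative_add, linear_solution hA hA' hAB γ hv, hder,
        comp_C_mul_X_pow_of_binomial hN ((hroot a).1 ha) hbin]
      ring
  rw [hset, Set.ncard_range_of_injective hinj, Nat.card_prod, Nat.card_prod, hroots,
    Nat.card_eq_fintype_card]

end Solutions

section QAdditive

variable {K : Type*} [Field K] {A : K[X]} {p q k m : ℕ} {ω : ℕ → K}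

lemma compAdditive_of_eq_sum [Fact p.Prime] [CharP K p] (hq : q = p ^ k)
    (h : A = ∑ i ∈ Finset.range (m + 1), C (ω i) * X ^ q ^ i) : CompAdditive A := by
  intro f g
  subst h
  simp only [Polynomial.sum_comp, mul_comp, C_comp, X_pow_comp, ← Finset.sum_add_distrib, ← mul_add]
  refine Finset.sum_congr rfl fun i _ => ?_
  rw [hq, ← pow_mul, add_pow_char_pow]

lemma exists_eq_pow_of_coeff_ne_zero
    (h : A = ∑ i ∈ Finset.range (m + 1), C (ω i) * X ^ q ^ i) {l : ℕ}
    (hl : A.coeff l ≠ 0) : ∃ i, l = q ^ i := by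
  by_contra! hne
  apply hl
  rw [h, finsetSum_coeff]
  refine Finset.sum_eq_zero fun i _ => ?_
  rw [coeff_C_mul_X_pow, if_neg (hne i)]

lemma derivative_eq_C_coeff_one (hq : (q : K) = 0)
    (h : A = ∑ i ∈ Finset.range (m + 1), C (ω i) * X ^ q ^ i) :
    derivative A = C (A.coeff 1) := by
  ext l
  rw [coeff_derivative, coeff_C]
  split_ifs with hl
  · simp [hl]
  · by_cases h0 : A.coeff (l + 1) = 0
    · rw [h0, zero_mul]
    · obtain ⟨i, hi⟩ := exists_eq_pow_of_coeff_ne_zero h h0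
      have hi0 : i ≠ 0 := by rintro rfl; simp at hi; exact hl hi
      have : ((l + 1 : ℕ) : K) = 0 := by rw [hi, Nat.cast_pow, hq, zero_pow hi0]
      rw [Nat.cast_succ] at this
      rw [this, mul_zero]

lemma natDegree_sub_X_pow_mul_two_le {t : ℕ} (hq2 : 2 ≤ q) (ht : t ≠ 0) (hm : A.Monic)
    (hdeg : A.natDegree = q ^ t)
    (h : A = ∑ i ∈ Finset.range (m + 1), C (ω i) * X ^ q ^ i) :
    (A - X ^ q ^ t).natDegree * 2 ≤ q ^ t := by
  have hle : (A - X ^ q ^ t).natDegree ≤ q ^ (t - 1) := by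
    rw [natDegree_le_iff_coeff_eq_zero]
    intro l hl
    rw [coeff_sub, coeff_X_pow]
    split_ifs with hlt
    · rw [hlt, ← hdeg, hm.coeff_natDegree, sub_self]
    · rw [sub_zero]
      by_contra h0
      have hlt' : l < q ^ t := by
        have := le_natDegree_of_ne_zero h0
        omega
      obtain ⟨i, rfl⟩ := exists_eq_pow_of_coeff_ne_zero h h0
      have h1 := (Nat.pow_lt_pow_iff_right (by omega)).1 hlt'
      have h2 := (Nat.pow_lt_pow_iff_right (by omega)).1 hl
      omega
  calc (A - X ^ q ^ t).natDegree * 2 ≤ q ^ (t - 1) * q := Nat.mul_le_mul hle hq2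
    _ = q ^ t := by rw [← pow_succ, Nat.sub_add_cancel (by omega)]

end QAdditive

/-- Same setting as Statement 17, with moreover `deg A = q^t ≥ q^{n/2}`
(i.e. `2t ≥ n`) and `d` minimal among the degrees `d'` for which some `X^{q^{d'}} − α'X`
satisfying (*) is a multiple of `A`. Then `|W(A|K)| = q^{d·2^{n/d} − d + t}`. -/
theorem stmt18 (q n d t : ℕ) (hq : IsPrimePow q) (hn : 1 ≤ n)
    (hd : 0 < d) (hdn : d ∣ n) (ht : n ≤ 2 * t)
    {K : Type*} [Field K] [Fintype K] (hK : Fintype.card K = q ^ n)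
    (A : K[X])
    (hAq : ∃ (m : ℕ) (ω : ℕ → K),
      A = ∑ i ∈ Finset.range (m + 1), C (ω i) * X ^ q ^ i)
    (hAmonic : A.Monic) (hAdeg : A.natDegree = q ^ t)
    (hAstar : 2 < A.natDegree ∧ Multiset.card A.roots = A.natDegree ∧ A.roots.Nodup)
    (α : K) (hα : α ≠ 0)
    (hstar : (X ^ q ^ d - C α * X : K[X]).Monic ∧
      2 < (X ^ q ^ d - C α * X : K[X]).natDegree ∧
      Multiset.card (X ^ q ^ d - C α * X : K[X]).roots =
        (X ^ q ^ d - C α * X : K[X]).natDegree ∧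
      (X ^ q ^ d - C α * X : K[X]).roots.Nodup)
    (hdvd : A ∣ X ^ q ^ d - C α * X)
    (hmin : ∀ (d' : ℕ) (α' : K), 0 < d' → α' ≠ 0 →
      ((X ^ q ^ d' - C α' * X : K[X]).Monic ∧
        2 < (X ^ q ^ d' - C α' * X : K[X]).natDegree ∧
        Multiset.card (X ^ q ^ d' - C α' * X : K[X]).roots =
          (X ^ q ^ d' - C α' * X : K[X]).natDegree ∧
        (X ^ q ^ d' - C α' * X : K[X]).roots.Nodup) →
      A ∣ X ^ q ^ d' - C α' * X → d ≤ d') :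
    {f : K[X] | ∃ θ : K, θ ≠ 0 ∧
      A.comp f = C θ * ((X ^ q ^ n - X) * f.derivative)}.ncard =
      q ^ (d * 2 ^ (n / d) - d + t) := by
  obtain ⟨p, k, hp, hk, hqk⟩ := hq
  have : Fact p.Prime := ⟨hp.nat_prime⟩
  have : CharP K p := charP_of_card_eq_prime_pow (p := p) (f := k * n)
    (by rw [hK, ← hqk, pow_mul])
  obtain ⟨m, ω, hsum⟩ := hAq
  obtain ⟨hA2, hAcard, hAnd⟩ := hAstar
  have hq2 : 2 ≤ q := by
    rw [← hqk]
    exact hp.nat_prime.two_le.trans (Nat.le_self_pow hk.ne' p)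
  have hq0 : (q : K) = 0 := by
    rw [← hqk, Nat.cast_pow, CharP.cast_eq_zero, zero_pow hk.ne']
  have ht0 : t ≠ 0 := by omega
  have hA := compAdditive_of_eq_sum hqk.symm hsum
  have hA' := derivative_eq_C_coeff_one hq0 hsum
  have hlow := natDegree_sub_X_pow_mul_two_le hq2 ht0 hAmonic hAdeg hsum
  have hroots := CompAdditive.card_root_subtype hAmonic hAcard hAnd
  obtain ⟨B, -, hN, hBA⟩ := hA.exists_comp_left hAmonic hA2 hAcard hAnd
  have hAB := hA.comp_right_of_comp_left (by omega) hBA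
  rw [hAdeg] at hA2 hroots hN
  have hBdeg (s : ℕ) (hs : n = t + s) : B.natDegree = q ^ s := by
    rw [hK, hs, pow_add] at hN
    exact Nat.eq_of_mul_eq_mul_left (by positivity) hN
  have hQe : q ^ t = p ^ (k * t) := by rw [← hqk, pow_mul]
  have htn : t ≤ n := by
    rw [hK] at hN
    exact (Nat.pow_dvd_pow_iff_le_right (by omega)).1 (Dvd.intro _ hN)
  have hdegd : (X ^ q ^ d - C α * X : K[X]).natDegree = q ^ d := by
    have h1 : 1 < q ^ d := Nat.one_lt_pow hd.ne' (by omega)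
    rw [natDegree_sub_eq_left_of_natDegree_lt, natDegree_X_pow]
    rw [natDegree_X_pow, natDegree_C_mul_X _ hα]
    exact h1
  have htd : t ≤ d := by
    have := natDegree_le_of_dvd hdvd hstar.1.ne_zero
    rw [hAdeg, hdegd] at this
    exact (Nat.pow_le_pow_iff_right (by omega)).1 this
  obtain ⟨s, hs⟩ := Nat.exists_eq_add_of_le htn
  rw [← hK]
  obtain ⟨c, hc⟩ := hdn
  have hc12 : c = 1 ∨ c = 2 := by
    rcases c with _ | _ | _ | c
    · omega
    · exact Or.inl rfl
    · exact Or.inr rfl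
    · exfalso
      nlinarith
  rcases hc12 with rfl | rfl
  · rw [mul_one] at hc
    rw [ncard_solutions_of_not_binomial hA hA' hQe hA2 hAdeg hroots hlow
      (by rw [hBdeg s hs]; exact Nat.pow_le_pow_right (by omega) (by omega)) hN hAB, hK,
      ← pow_add, hc, Nat.div_self hd]
    · congr 1
      omega
    · intro hBQ hbin
      rw [hBdeg s hs] at hBQ
      have hst := Nat.pow_right_injective hq2 hBQ
      have hbin' : A = X ^ q ^ t - C (-A.coeff 1) * X := by
        rw [C_neg, neg_mul, sub_neg_eq_add]
        exact hbin
      have := hmin t (-A.coeff 1) (by omega)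
        (neg_ne_zero.2 (derivative_right_factor hA' hAB).1)
        (by rw [← hbin', hAdeg]; exact ⟨hAmonic, hA2, by rw [hAcard, hAdeg], hAnd⟩)
        (by rw [← hbin'])
      omega
  · obtain rfl : t = d := by omega
    have hBQ := hBdeg t (by omega)
    have hAeq : A = X ^ q ^ t - C α * X :=
      (eq_of_monic_of_dvd_of_natDegree_le hAmonic hstar.1 hdvd (by rw [hdegd, hAdeg])).symm
    have hcoeff : A.coeff 1 = -α := by
      rw [hAeq, coeff_sub, coeff_X_pow, if_neg (by omega), coeff_C_mul_X]
      simp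
    rw [ncard_solutions_of_binomial hA hA' hQe hA2 hAdeg hroots hlow hBQ 
      (by rw [← hN, hBQ]) hAB
      (by rw [hcoeff, C_neg, neg_mul, ← sub_eq_add_neg, ← hAeq]), hK, ← pow_add, ← pow_add,
      hc, Nat.mul_div_cancel_left 2 hd]
    congr 1
    omega
end
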